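/- arXiv:math/0412318 — 2 statements merged into one kernel-verified Lean document; each statement's English description precedes it below -/
import Mathlib

section
/- Let V and W be finite-dimensional real vector spaces, φ : V → W a linear map, and L ⊆ W × W* a maximal isotropic subspace for the canonical symmetric form g((X, α), (Y, β)) = (1/2)(β(X) + α(Y)) on W × W*. Then the backward image φ*L := { (Z, α ∘ φ) : Z ∈ V, α ∈ W*, (φ(Z), α) ∈ L } is a maximal isotropic subspace of V × V* for the canonical symmetric form on V × V*. -/
/-- The canonical symmetric pairing `g((X,α),(Y,β)) = (1/2)(β(X) + α(Y))` on `U × U*`. -/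
noncomputable def cpair {U : Type*} [AddCommGroup U] [Module ℝ U]
    (p q : U × Module.Dual ℝ U) : ℝ :=
  (1/2 : ℝ) * (q.2 p.1 + p.2 q.1)

/-- A subspace of `U × U*` is isotropic if the canonical pairing vanishes on it. -/
def IsIsotropic {U : Type*} [AddCommGroup U] [Module ℝ U]
    (L : Submodule ℝ (U × Module.Dual ℝ U)) : Prop :=
  ∀ p ∈ L, ∀ q ∈ L, cpair p q = 0

/-- The backward image `φ*L = {(Z, α ∘ φ) : (φ Z, α) ∈ L}` of `L ⊆ W × W*` under a
linear map `φ : V → W`. -/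
def backwardImage {V W : Type*} [AddCommGroup V] [Module ℝ V] [AddCommGroup W]
    [Module ℝ W] (φ : V →ₗ[ℝ] W) (L : Submodule ℝ (W × Module.Dual ℝ W)) :
    Submodule ℝ (V × Module.Dual ℝ V) :=
  Submodule.map ((LinearMap.id : V →ₗ[ℝ] V).prodMap φ.dualMap)
    (Submodule.comap
      (φ.prodMap (LinearMap.id : Module.Dual ℝ W →ₗ[ℝ] Module.Dual ℝ W)) L)

theorem cpair_eq_zero_iff {U : Type*} [AddCommGroup U] [Module ℝ U]
    {p q : U × Module.Dual ℝ U} : cpair p q = 0 ↔ q.2 p.1 + p.2 q.1 = 0 := by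
  simp [cpair]

theorem mem_backwardImage_iff {V W : Type*} [AddCommGroup V] [Module ℝ V] [AddCommGroup W]
    [Module ℝ W] {φ : V →ₗ[ℝ] W} {L : Submodule ℝ (W × Module.Dual ℝ W)}
    {Z : V} {β : Module.Dual ℝ V} :
    (Z, β) ∈ backwardImage φ L ↔ ∃ α : Module.Dual ℝ W, (φ Z, α) ∈ L ∧ β = α ∘ₗ φ := by
  constructor
  · rintro ⟨⟨Y, α⟩, h, he⟩
    obtain ⟨rfl, rfl⟩ := Prod.ext_iff.1 he
    exact ⟨α, h, rfl⟩
  · rintro ⟨α, h, rfl⟩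
    exact ⟨(Z, α), h, rfl⟩

theorem IsIsotropic.backwardImage {V W : Type*} [AddCommGroup V] [Module ℝ V] [AddCommGroup W]
    [Module ℝ W] {L : Submodule ℝ (W × Module.Dual ℝ W)} (hL : IsIsotropic L)
    (φ : V →ₗ[ℝ] W) : IsIsotropic (backwardImage φ L) := by
  rintro ⟨X, ξ⟩ hp ⟨Y, η⟩ hq
  obtain ⟨α, hα, rfl⟩ := mem_backwardImage_iff.1 hp
  obtain ⟨β, hβ, rfl⟩ := mem_backwardImage_iff.1 hq
  exact hL _ hα _ hβ

/-- A maximal isotropic subspace contains every covector annihilating its projection to `U`. -/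
theorem zero_prod_mem_of_maximal_isotropic {U : Type*} [AddCommGroup U] [Module ℝ U]
    {L : Submodule ℝ (U × Module.Dual ℝ U)} (hiso : IsIsotropic L)
    (hmax : ∀ L' : Submodule ℝ (U × Module.Dual ℝ U), IsIsotropic L' → L ≤ L' → L' = L)
    {α : Module.Dual ℝ U} (hα : ∀ p ∈ L, α p.1 = 0) : ((0 : U), α) ∈ L := by
  rw [← hmax (L ⊔ Submodule.span ℝ {((0 : U), α)}) ?_ le_sup_left]
  · exact Submodule.mem_sup_right (Submodule.mem_span_singleton_self _)
  · intro p hp q hq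
    obtain ⟨p, hpL, _, hs, rfl⟩ := Submodule.mem_sup.1 hp
    obtain ⟨q, hqL, _, ht, rfl⟩ := Submodule.mem_sup.1 hq
    obtain ⟨s, rfl⟩ := Submodule.mem_span_singleton.1 hs
    obtain ⟨t, rfl⟩ := Submodule.mem_span_singleton.1 ht
    simpa [cpair_eq_zero_iff, hα p hpL, hα q hqL] using cpair_eq_zero_iff.1 (hiso p hpL q hqL)

/-- The backward image of a maximal isotropic subspace contains its own orthogonal complement. -/
theorem mem_backwardImage_of_orthogonal {V W : Type*} [AddCommGroup V] [Module ℝ V]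
    [AddCommGroup W] [Module ℝ W] {φ : V →ₗ[ℝ] W} {L : Submodule ℝ (W × Module.Dual ℝ W)}
    (hiso : IsIsotropic L)
    (hmax : ∀ L' : Submodule ℝ (W × Module.Dual ℝ W), IsIsotropic L' → L ≤ L' → L' = L)
    {p : V × Module.Dual ℝ V} (hp : ∀ q ∈ backwardImage φ L, cpair p q = 0) :
    p ∈ backwardImage φ L := by
  obtain ⟨Z, β⟩ := p
  let E : Submodule ℝ W := L.map (LinearMap.fst ℝ W (Module.Dual ℝ W))
  have mem_of_annihilator : ∀ α ∈ E.dualAnnihilator, ((0 : W), α) ∈ L := fun α hα =>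
    zero_prod_mem_of_maximal_isotropic hiso hmax fun q hq =>
      (Submodule.mem_dualAnnihilator α).1 hα _ ⟨q, hq, rfl⟩
  have hZ : φ Z ∈ E := by
    refine (Subspace.forall_mem_dualAnnihilator_apply_eq_zero_iff E _).1 fun α hα => ?_
    simpa using cpair_eq_zero_iff.1 (hp (0, α ∘ₗ φ)
      (mem_backwardImage_iff.2 ⟨α, by simpa using mem_of_annihilator α hα, rfl⟩))
  obtain ⟨⟨_, α⟩, hα, rfl : _ = φ Z⟩ := hZ
  have hker : β - α ∘ₗ φ ∈ (LinearMap.ker (E.mkQ ∘ₗ φ)).dualAnnihilator := by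
    rw [Submodule.mem_dualAnnihilator]
    intro Y hY
    obtain ⟨⟨_, γ⟩, hγ, rfl : _ = φ Y⟩ : φ Y ∈ E := by simpa using hY
    have h₁ := cpair_eq_zero_iff.1 (hp (Y, γ ∘ₗ φ) (mem_backwardImage_iff.2 ⟨γ, hγ, rfl⟩))
    have h₂ := cpair_eq_zero_iff.1 (hiso _ hα _ hγ)
    simp only [LinearMap.comp_apply, LinearMap.sub_apply] at h₁ h₂ ⊢
    linarith
  rw [← LinearMap.range_dualMap_eq_dualAnnihilator_ker] at hker
  obtain ⟨δ, hδ⟩ := hker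
  refine mem_backwardImage_iff.2 ⟨α + δ ∘ₗ E.mkQ, ?_, ?_⟩
  · have hmem : ((0 : W), δ ∘ₗ E.mkQ) ∈ L := by
      refine mem_of_annihilator _ ((Submodule.mem_dualAnnihilator _).2 fun w hw => ?_)
      simp [(Submodule.Quotient.mk_eq_zero E).2 hw]
    simpa using L.add_mem hα hmem
  · rw [LinearMap.add_comp, ← sub_eq_iff_eq_add', ← hδ]
    rfl

/-- The backward image `φ*L = {(Z, α ∘ φ) : (φ Z, α) ∈ L}` of a
maximal isotropic `L ⊆ W × W*` under a linear map `φ : V → W` is a maximal isotropic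
subspace of `V × V*`. -/
theorem stmt12 {V W : Type*} [AddCommGroup V] [Module ℝ V] [FiniteDimensional ℝ V]
    [AddCommGroup W] [Module ℝ W] [FiniteDimensional ℝ W]
    (φ : V →ₗ[ℝ] W)
    (L : Submodule ℝ (W × Module.Dual ℝ W))
    (hiso : IsIsotropic L)
    (hmax : ∀ L' : Submodule ℝ (W × Module.Dual ℝ W), IsIsotropic L' → L ≤ L' → L' = L) :
    (∀ (Z : V) (β : Module.Dual ℝ V),
      (Z, β) ∈ backwardImage φ L ↔
        ∃ α : Module.Dual ℝ W, (φ Z, α) ∈ L ∧ β = α ∘ₗ φ) ∧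
    IsIsotropic (backwardImage φ L) ∧
    (∀ L' : Submodule ℝ (V × Module.Dual ℝ V), IsIsotropic L' →
      backwardImage φ L ≤ L' → L' = backwardImage φ L) := by
  exact ⟨fun _ _ => mem_backwardImage_iff, hiso.backwardImage φ, fun L' hL' hle =>
    le_antisymm (fun p hp => mem_backwardImage_of_orthogonal hiso hmax fun q hq =>
      hL' p hp q (hle hq)) hle⟩
end

section
/- Let V and W be finite-dimensional real vector spaces, φ : V → W a linear map, and L ⊆ V × V* a maximal isotropic subspace for the canonical symmetric form on V × V*. Then the forward image φ_*L := { (φ(Z), α) : Z ∈ V, α ∈ W*, (Z, α ∘ φ) ∈ L } is a maximal isotropic subspace of W × W* for the canonical symmetric form on W × W*. -/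
/-- The forward image `φ_*L = {(φ Z, α) : (Z, α ∘ φ) ∈ L}` of `L ⊆ V × V*` under a
linear map `φ : V → W`. -/
def forwardImage {V W : Type*} [AddCommGroup V] [Module ℝ V] [AddCommGroup W]
    [Module ℝ W] (φ : V →ₗ[ℝ] W) (L : Submodule ℝ (V × Module.Dual ℝ V)) :
    Submodule ℝ (W × Module.Dual ℝ W) :=
  Submodule.map (φ.prodMap (LinearMap.id : Module.Dual ℝ W →ₗ[ℝ] Module.Dual ℝ W))
    (Submodule.comap ((LinearMap.id : V →ₗ[ℝ] V).prodMap φ.dualMap) L)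

/-- The canonical pairing `cpair` as a bilinear form. -/
noncomputable def cpairForm (U : Type*) [AddCommGroup U] [Module ℝ U] :
    LinearMap.BilinForm ℝ (U × Module.Dual ℝ U) :=
  LinearMap.mk₂ ℝ cpair
    (by intros; simp [cpair]; ring) (by intros; simp [cpair]; ring)
    (by intros; simp [cpair]; ring) (by intros; simp [cpair]; ring)

section

variable {U : Type*} [AddCommGroup U] [Module ℝ U]

theorem cpair_comm (p q : U × Module.Dual ℝ U) : cpair p q = cpair q p := by
  simp only [cpair]; ring

theorem cpair_add_smul_add_smul (p q p' q' : U × Module.Dual ℝ U) (s t : ℝ) :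
    cpair (p + s • q) (p' + t • q') =
      cpair p p' + t * cpair p q' + s * cpair q p' + s * t * cpair q q' := by
  simp [cpair]; ring

theorem nondegenerate_cpairForm : (cpairForm U).Nondegenerate := by
  have hsep : ∀ p : U × Module.Dual ℝ U, (∀ q, cpair p q = 0) → p = 0 := by
    rintro ⟨X, α⟩ h
    ext1
    · refine (Module.forall_dual_apply_eq_zero_iff ℝ X).1 fun β => ?_
      simpa [cpair] using h (0, β)
    · ext Y
      simpa [cpair] using h (Y, 0)
  exact ⟨hsep, fun p h => hsep p fun q => by rw [cpair_comm]; exact h q⟩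

theorem IsIsotropic.le_orthogonal {L : Submodule ℝ (U × Module.Dual ℝ U)}
    (hL : IsIsotropic L) : L ≤ (cpairForm U).orthogonal L :=
  fun p hp q hq => hL q hq p hp

/-- Adjoining an orthogonal null vector to an isotropic subspace keeps it isotropic. -/
theorem IsIsotropic.sup_span_singleton {L : Submodule ℝ (U × Module.Dual ℝ U)}
    (hL : IsIsotropic L) {q : U × Module.Dual ℝ U}
    (hq : q ∈ (cpairForm U).orthogonal L) (hqq : cpair q q = 0) :
    IsIsotropic (L ⊔ Submodule.span ℝ {q}) := by
  have hLq : ∀ p ∈ L, cpair p q = 0 := hq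
  intro a ha b hb
  obtain ⟨p, hp, _, hs, rfl⟩ := Submodule.mem_sup.1 ha
  obtain ⟨s, rfl⟩ := Submodule.mem_span_singleton.1 hs
  obtain ⟨p', hp', _, ht, rfl⟩ := Submodule.mem_sup.1 hb
  obtain ⟨t, rfl⟩ := Submodule.mem_span_singleton.1 ht
  rw [cpair_add_smul_add_smul, hL p hp p' hp', hLq p hp, cpair_comm q, hLq p' hp', hqq]
  ring

/-- A maximal isotropic subspace contains every null vector orthogonal to it. -/
theorem mem_of_maximal_isotropic {L : Submodule ℝ (U × Module.Dual ℝ U)}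
    (hL : IsIsotropic L)
    (hmax : ∀ L' : Submodule ℝ (U × Module.Dual ℝ U), IsIsotropic L' → L ≤ L' → L' = L)
    {q : U × Module.Dual ℝ U} (hq : q ∈ (cpairForm U).orthogonal L) (hqq : cpair q q = 0) :
    q ∈ L := by
  rw [← hmax _ (hL.sup_span_singleton hq hqq) le_sup_left]
  exact Submodule.mem_sup_right (Submodule.mem_span_singleton_self q)

variable [FiniteDimensional ℝ U]

variable (U) in
theorem exists_posDef_toDual :
    ∃ f : U →ₗ[ℝ] Module.Dual ℝ U, ∀ x, x ≠ 0 → 0 < f x x := by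
  classical
  let b := Module.finBasis ℝ U
  have hb : ∀ x, b.toDual x x = ∑ i, b.repr x i * b.repr x i := fun x => by
    calc b.toDual x x = b.toDual x (∑ i, b.repr x i • b i) := by rw [b.sum_repr]
      _ = _ := by simp only [map_sum, map_smul, b.toDual_apply_left, smul_eq_mul]
  refine ⟨b.toDual, fun x hx => ?_⟩
  rw [hb]
  refine lt_of_le_of_ne (Finset.sum_nonneg fun i _ => mul_self_nonneg _) fun h => hx ?_
  refine b.ext_elem fun i => ?_
  have := (Finset.sum_eq_zero_iff_of_nonneg fun i _ => mul_self_nonneg (b.repr x i)).1 h.symm i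
    (Finset.mem_univ i)
  simpa using this

/-- A subspace on which the canonical pairing is semidefinite, with sign given by `ε`,
has dimension at most `dim U`. -/
theorem finrank_le_of_semidefinite {ε : ℝ} (hε : ε ≠ 0) (S : Submodule ℝ (U × Module.Dual ℝ U))
    (hS : ∀ p ∈ S, 0 ≤ ε * cpair p p) : Module.finrank ℝ S ≤ Module.finrank ℝ U := by
  obtain ⟨f, hf⟩ := exists_posDef_toDual U
  let j : U →ₗ[ℝ] U × Module.Dual ℝ U := LinearMap.id.prod (-ε • f)
  have hj : Function.Injective j := fun x y h => congrArg Prod.fst h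
  have hdisj : Disjoint S (LinearMap.range j) := by
    rw [Submodule.disjoint_def]
    rintro _ hx ⟨x, rfl⟩
    by_contra hne
    have hx0 : x ≠ 0 := by rintro rfl; exact hne (map_zero j)
    have hneg : ε * cpair (j x) (j x) = -(ε ^ 2 * f x x) := by
      simp [cpair, j]; ring
    have hpos : 0 < ε ^ 2 * f x x := mul_pos (by positivity) (hf x hx0)
    linarith [hS _ hx]
  have hdim := Submodule.finrank_add_finrank_le_of_disjoint hdisj
  rw [LinearMap.finrank_range_of_inj hj, Module.finrank_prod, Subspace.dual_finrank_eq] at hdim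
  omega

/-- A maximal isotropic subspace is its own orthogonal complement. -/
theorem orthogonal_eq_of_maximal_isotropic {L : Submodule ℝ (U × Module.Dual ℝ U)}
    (hL : IsIsotropic L)
    (hmax : ∀ L' : Submodule ℝ (U × Module.Dual ℝ U), IsIsotropic L' → L ≤ L' → L' = L) :
    (cpairForm U).orthogonal L = L := by
  have hle : Module.finrank ℝ ((cpairForm U).orthogonal L) ≤ Module.finrank ℝ U := by
    by_cases h : ∃ q ∈ (cpairForm U).orthogonal L, 0 < cpair q q
    · obtain ⟨q, hq, hqq⟩ := h
      refine finrank_le_of_semidefinite one_ne_zero _ fun p hp => ?_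
      rw [one_mul]
      by_contra! hpp
      obtain ⟨t, ht⟩ : ∃ t, cpair q q * (t * t) + 2 * cpair p q * t + cpair p p = 0 := by
        refine exists_quadratic_eq_zero hqq.ne' ⟨√(discrim _ _ _), (Real.mul_self_sqrt ?_).symm⟩
        rw [discrim]
        nlinarith [sq_nonneg (cpair p q), mul_neg_of_pos_of_neg hqq hpp]
      have hr : p + t • q ∈ (cpairForm U).orthogonal L := add_mem hp (Submodule.smul_mem _ t hq)
      have hrr : cpair (p + t • q) (p + t • q) = 0 := by
        rw [cpair_add_smul_add_smul, cpair_comm q p, ← ht]; ring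
      have hrq : cpair (p + t • q) q = 0 := hq _ (mem_of_maximal_isotropic hL hmax hr hrr)
      have hrq' : cpair p q + t * cpair q q = 0 := by
        rw [← hrq]; simp [cpair]; ring
      have hp_eq : cpair p p = t * t * cpair q q := by linear_combination ht - 2 * t * hrq'
      linarith [mul_nonneg (mul_self_nonneg t) hqq.le]
    · push Not at h
      exact finrank_le_of_semidefinite (ε := -1) (by norm_num) _ fun p hp => by
        linarith [h p hp]
  have hdim := LinearMap.BilinForm.finrank_orthogonal (nondegenerate_cpairForm (U := U)) L
  rw [Module.finrank_prod, Subspace.dual_finrank_eq] at hdim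
  exact (Submodule.eq_of_le_of_finrank_le hL.le_orthogonal (by omega)).symm

end

section

variable {V W : Type*} [AddCommGroup V] [Module ℝ V] [AddCommGroup W] [Module ℝ W]

theorem mem_forwardImage {φ : V →ₗ[ℝ] W} {L : Submodule ℝ (V × Module.Dual ℝ V)}
    {X : W} {α : Module.Dual ℝ W} :
    (X, α) ∈ forwardImage φ L ↔ ∃ Z : V, (Z, α ∘ₗ φ) ∈ L ∧ X = φ Z := by
  constructor
  · rintro ⟨⟨Z, β⟩, hZ, h⟩
    obtain ⟨rfl, rfl⟩ := Prod.mk.inj h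
    exact ⟨Z, hZ, rfl⟩
  · rintro ⟨Z, hZ, rfl⟩
    exact ⟨(Z, α), hZ, rfl⟩

theorem IsIsotropic.forwardImage {φ : V →ₗ[ℝ] W} {L : Submodule ℝ (V × Module.Dual ℝ V)}
    (hL : IsIsotropic L) : IsIsotropic (forwardImage φ L) := by
  rintro ⟨_, α⟩ hp ⟨_, β⟩ hq
  obtain ⟨Z, hZ, rfl⟩ := mem_forwardImage.1 hp
  obtain ⟨Z', hZ', rfl⟩ := mem_forwardImage.1 hq
  exact hL _ hZ _ hZ'

/-- If `L` is its own orthogonal complement, then `forwardImage φ L` contains its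
orthogonal complement. -/
theorem orthogonal_forwardImage_le [FiniteDimensional ℝ V] {φ : V →ₗ[ℝ] W}
    {L : Submodule ℝ (V × Module.Dual ℝ V)} (hL : (cpairForm V).orthogonal L = L) :
    (cpairForm W).orthogonal (forwardImage φ L) ≤ forwardImage φ L := by
  rintro ⟨Y, β⟩ hY
  let j : V × Module.Dual ℝ W →ₗ[ℝ] V × Module.Dual ℝ V := LinearMap.id.prodMap φ.dualMap
  let k : V × Module.Dual ℝ W →ₗ[ℝ] W × Module.Dual ℝ W := φ.prodMap LinearMap.id
  let Φ : Submodule ℝ (Module.Dual ℝ (V × Module.Dual ℝ W)) :=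
    L.map (j.dualMap ∘ₗ cpairForm V)
  have hmem : k.dualMap (cpairForm W (Y, β)) ∈ Φ := by
    rw [← Subspace.dualCoannihilator_dualAnnihilator_eq (W := Φ), Submodule.mem_dualAnnihilator]
    intro m hm
    rw [Submodule.mem_dualCoannihilator] at hm
    have hjm : j m ∈ L := by
      rw [← hL]
      exact fun l hl => hm _ ⟨l, hl, rfl⟩
    change cpair (Y, β) (k m) = 0
    rw [cpair_comm]
    exact hY _ ⟨m, hjm, rfl⟩
  obtain ⟨⟨Z, γ⟩, hZ, h⟩ := hmem
  have heval : ∀ m, cpair (Z, γ) (j m) = cpair (Y, β) (k m) := LinearMap.congr_fun h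
  have hγ : γ = β ∘ₗ φ := by
    ext X
    simpa [cpair, j, k] using heval (X, 0)
  have hYZ : Y = φ Z := by
    rw [eq_comm, ← sub_eq_zero]
    refine (Module.forall_dual_apply_eq_zero_iff ℝ _).1 fun α => ?_
    rw [map_sub, sub_eq_zero]
    simpa [cpair, j, k] using heval (0, α)
  exact mem_forwardImage.2 ⟨Z, hγ ▸ hZ, hYZ⟩

end

/-- The forward image `φ_*L = {(φ Z, α) : (Z, α ∘ φ) ∈ L}` of a
maximal isotropic `L ⊆ V × V*` under a linear map `φ : V → W` is a maximal isotropic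
subspace of `W × W*`. -/
theorem stmt13 {V W : Type*} [AddCommGroup V] [Module ℝ V] [FiniteDimensional ℝ V]
    [AddCommGroup W] [Module ℝ W] [FiniteDimensional ℝ W]
    (φ : V →ₗ[ℝ] W)
    (L : Submodule ℝ (V × Module.Dual ℝ V))
    (hiso : IsIsotropic L)
    (hmax : ∀ L' : Submodule ℝ (V × Module.Dual ℝ V), IsIsotropic L' → L ≤ L' → L' = L) :
    (∀ (X : W) (α : Module.Dual ℝ W),
      (X, α) ∈ forwardImage φ L ↔
        ∃ Z : V, (Z, α ∘ₗ φ) ∈ L ∧ X = φ Z) ∧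
    IsIsotropic (forwardImage φ L) ∧
    (∀ L' : Submodule ℝ (W × Module.Dual ℝ W), IsIsotropic L' →
      forwardImage φ L ≤ L' → L' = forwardImage φ L) := by
  refine ⟨fun X α => mem_forwardImage, hiso.forwardImage, fun L' hL' hle => le_antisymm ?_ hle⟩
  exact fun p hp => orthogonal_forwardImage_le (orthogonal_eq_of_maximal_isotropic hiso hmax)
    fun q hq => hL' q (hle hq) p hp
end
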